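/- Let A₁,…,A_d ∈ M_N(ℂ) with A_d invertible, and assume that for every real (η,ξ) ∈ ℝ^{d−1}×ℝ the matrix A(η,ξ) := Σ_{j<d} η_jA_j + ξA_d has only real eigenvalues. Let (τ̄,η̄,ξ̄) be real and such that −τ̄ is a semisimple eigenvalue of A(η̄,ξ̄) of algebraic multiplicity m, i.e. ℂ^N = ker(τ̄I + A(η̄,ξ̄)) ⊕ range(τ̄I + A(η̄,ξ̄)) and the kernel has dimension m. Assume the root is nonglancing: the homogeneous degree-m term Δ̄ of the Taylor expansion of Δ(τ,η,ξ) := det(τI + A(η,ξ)) at (τ̄,η̄,ξ̄) satisfies Δ̄(0,…,0,1) ≠ 0. Then −ξ̄ is a semisimple eigenvalue of algebraic multiplicity m of the matrix G(τ̄,η̄) := A_d^{−1}(τ̄I + Σ_{j<d} η̄_jA_j). -/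

import Mathlib

/-- The characteristic polynomial `Δ(τ,η,ξ) = det(τI + Σ_{j<d} η_j A_j + ξ A_d)` of a
first-order system near a boundary, as a multivariate polynomial in the variables
`(τ, η₁,…,η_{d−1}, ξ)`: variable `0` is `τ`, variable `j.castSucc.succ` is `η_j`, and the
last variable is `ξ`.  Here `A` lists the tangential matrices and `Ad` is the normal one. -/
noncomputable def charMvPolyBdry {N d : ℕ} (A : Fin d → Matrix (Fin N) (Fin N) ℂ)
    (Ad : Matrix (Fin N) (Fin N) ℂ) : MvPolynomial (Fin (d + 2)) ℂ :=
  ((MvPolynomial.X 0 : MvPolynomial (Fin (d + 2)) ℂ)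
      • (1 : Matrix (Fin N) (Fin N) (MvPolynomial (Fin (d + 2)) ℂ))
    + ∑ j : Fin d, (MvPolynomial.X j.castSucc.succ : MvPolynomial (Fin (d + 2)) ℂ)
      • (A j).map (fun z => MvPolynomial.C z)
    + (MvPolynomial.X (Fin.last (d + 1)) : MvPolynomial (Fin (d + 2)) ℂ)
      • Ad.map (fun z => MvPolynomial.C z)).det

/-- The homogeneous degree-`m` term of the Taylor expansion of `Δ` at the real point
`(tb, hb, xb)`. -/
noncomputable def taylorTermBdry {N d : ℕ} (A : Fin d → Matrix (Fin N) (Fin N) ℂ)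
    (Ad : Matrix (Fin N) (Fin N) ℂ) (tb : ℝ) (hb : Fin d → ℝ) (xb : ℝ) (m : ℕ) :
    MvPolynomial (Fin (d + 2)) ℂ :=
  MvPolynomial.homogeneousComponent m
    (MvPolynomial.bind₁
      (fun i => MvPolynomial.X i
        + MvPolynomial.C ((Fin.cons (tb : ℂ) (Fin.snoc (fun j => (hb j : ℂ)) (xb : ℂ))
            : Fin (d + 2) → ℂ) i))
      (charMvPolyBdry A Ad))

open Polynomial in
/-- Evaluating the homogeneous component of degree `m` at `v` gives the coefficient of `X ^ m`
in the restriction of the polynomial to the line spanned by `v`. -/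
theorem eval_homogeneousComponent_eq_coeff {σ R : Type*} [CommRing R] (v : σ → R)
    (m : ℕ) (p : MvPolynomial σ R) :
    MvPolynomial.eval v (MvPolynomial.homogeneousComponent m p) =
      (MvPolynomial.aeval (fun i => (C (v i) * X : R[X])) p).coeff m := by
  induction p using MvPolynomial.induction_on' with
  | add p q hp hq => simp only [map_add, coeff_add, hp, hq]
  | monomial u a =>
    have hu : MvPolynomial.aeval (fun i => (C (v i) * X : R[X])) (MvPolynomial.monomial u a) =
        C (MvPolynomial.eval v (MvPolynomial.monomial u a)) * X ^ u.degree := by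
      simp only [MvPolynomial.aeval_monomial, MvPolynomial.eval_monomial, Finsupp.prod, mul_pow,
        Finset.prod_mul_distrib, Finset.prod_pow_eq_pow_sum, map_mul, map_prod, map_pow,
        Finsupp.degree, algebraMap_eq, mul_assoc]
      rfl
    rw [hu, coeff_C_mul_X_pow,
      MvPolynomial.homogeneousComponent_of_mem
        (MvPolynomial.isHomogeneous_monomial (d := u) a rfl)]
    split_ifs <;> simp_all

/-- If the coefficient of degree `dim ker f` of the characteristic polynomial does not vanish,
then `0` is a semisimple eigenvalue of `f`. -/
theorem LinearMap.isCompl_ker_range_of_coeff_charpoly_ne_zero {K V : Type*} [Field K]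
    [AddCommGroup V] [Module K V] [FiniteDimensional K V] (f : V →ₗ[K] V)
    (h : f.charpoly.coeff (Module.finrank K (LinearMap.ker f)) ≠ 0) :
    IsCompl (LinearMap.ker f) (LinearMap.range f) := by
  have hle : LinearMap.ker f ≤ Module.End.maxGenEigenspace f 0 := by
    intro x hx
    rw [Module.End.mem_maxGenEigenspace]
    exact ⟨1, by simpa using hx⟩
  have heq : LinearMap.ker f = Module.End.maxGenEigenspace f 0 := by
    refine Submodule.eq_of_le_of_finrank_le hle ?_
    rw [LinearMap.finrank_maxGenEigenspace_zero_eq]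
    exact Polynomial.natTrailingDegree_le_of_ne_zero h
  have hdisj : Disjoint (LinearMap.ker f) (LinearMap.range f) := by
    rw [Submodule.disjoint_def]
    rintro _ hx ⟨y, rfl⟩
    have hy : y ∈ Module.End.maxGenEigenspace f 0 := by
      rw [Module.End.mem_maxGenEigenspace]
      exact ⟨2, by simpa [pow_two] using hx⟩
    rwa [← heq, LinearMap.mem_ker] at hy
  exact (Submodule.isCompl_iff_disjoint _ _
    (by rw [add_comm, LinearMap.finrank_range_add_finrank_ker])).2 hdisj

open Polynomial in
/-- The restriction of the characteristic polynomial to the line through the base point in the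
normal direction is, up to the factor `det Ad`, the characteristic polynomial of `-(ξI + G)`. -/
theorem aeval_bind₁_charMvPolyBdry {N d : ℕ}
    (A : Fin d → Matrix (Fin N) (Fin N) ℂ) (Ad : Matrix (Fin N) (Fin N) ℂ)
    (hAd : IsUnit Ad.det) (t : ℂ) (η : Fin d → ℂ) (ξ : ℂ) :
    MvPolynomial.aeval
        (fun i => (C ((Fin.cons (0 : ℂ) (Fin.snoc (fun _ => (0 : ℂ)) (1 : ℂ)) :
          Fin (d + 2) → ℂ) i) * X : ℂ[X]))
        (MvPolynomial.bind₁
          (fun i => MvPolynomial.X i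
            + MvPolynomial.C ((Fin.cons t (Fin.snoc η ξ) : Fin (d + 2) → ℂ) i))
          (charMvPolyBdry A Ad)) =
      C Ad.det * (-(ξ • (1 : Matrix (Fin N) (Fin N) ℂ)
        + Ad⁻¹ * (t • (1 : Matrix (Fin N) (Fin N) ℂ) + ∑ j, η j • A j))).charpoly := by
  have hM : Ad * (ξ • (1 : Matrix (Fin N) (Fin N) ℂ)
      + Ad⁻¹ * (t • (1 : Matrix (Fin N) (Fin N) ℂ) + ∑ j, η j • A j)) =
      ξ • Ad + (t • (1 : Matrix (Fin N) (Fin N) ℂ) + ∑ j, η j • A j) := by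
    rw [mul_add, Matrix.mul_nonsing_inv_cancel_left _ _ hAd, mul_smul_comm, mul_one]
  have hlast : Fin.last (d + 1) = (Fin.last d).succ := rfl
  rw [← AlgHom.comp_apply, charMvPolyBdry, AlgHom.map_det, Matrix.charpoly, RingHom.map_det,
    ← Matrix.det_mul]
  congr 1
  have hR : (C : ℂ →+* ℂ[X]).mapMatrix Ad * Matrix.charmatrix (-(ξ • (1 : Matrix (Fin N) (Fin N) ℂ)
        + Ad⁻¹ * (t • (1 : Matrix (Fin N) (Fin N) ℂ) + ∑ j, η j • A j))) =
      (X : ℂ[X]) • C.mapMatrix Ad + C.mapMatrix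
        (ξ • Ad + (t • (1 : Matrix (Fin N) (Fin N) ℂ) + ∑ j, η j • A j)) := by
    rw [← hM, Matrix.charmatrix, mul_sub, map_neg, mul_neg, sub_neg_eq_add, map_mul C.mapMatrix,
      ← Matrix.scalar_comm _ (fun _ => Commute.all _ _), Matrix.scalar_apply,
      ← Matrix.smul_eq_diagonal_mul]
  rw [hR]
  ext1 i j
  simp [Matrix.sum_apply, Matrix.one_apply, hlast, -Fin.succ_last]
  split_ifs <;> simp <;> ring

/-- **Nonglancing semisimple roots give semisimple eigenvalues of the boundary symbol
(Proposition 3.8, first part).**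
Let `A₁,…,A_{d−1}` (the family `A`) and `A_d = Ad` with `Ad` invertible, assume that for
every real `(η,ξ)` the matrix `Σ η_j A_j + ξ Ad` has only real eigenvalues.  Let
`(τ̄,η̄,ξ̄)` be real, with `−τ̄` a semisimple eigenvalue of `A(η̄,ξ̄)` of algebraic
multiplicity `m` (i.e. `ℂ^N = ker(τ̄I + A(η̄,ξ̄)) ⊕ range(τ̄I + A(η̄,ξ̄))` with
`dim ker = m`).  Assume the root is nonglancing: the homogeneous degree-`m` Taylor term
`Δ̄` of `Δ` at `(τ̄,η̄,ξ̄)` satisfies `Δ̄(0,…,0,1) ≠ 0`.  Then `−ξ̄` is a semisimple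
eigenvalue of algebraic multiplicity `m` of `G(τ̄,η̄) := Ad⁻¹(τ̄I + Σ η̄_j A_j)`, i.e.
`ℂ^N = ker(ξ̄I + G) ⊕ range(ξ̄I + G)` with `dim ker(ξ̄I + G) = m`. -/
theorem nonglancing_semisimple_transfer {N d : ℕ}
    (A : Fin d → Matrix (Fin N) (Fin N) ℂ) (Ad : Matrix (Fin N) (Fin N) ℂ)
    (hAd : IsUnit Ad.det)
    (hreal : ∀ (η : Fin d → ℝ) (ξ : ℝ),
      ∀ μ ∈ spectrum ℂ ((∑ j, (η j : ℂ) • A j) + (ξ : ℂ) • Ad), μ.im = 0)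
    (tb : ℝ) (hb : Fin d → ℝ) (xb : ℝ) (m : ℕ)
    (hsemi : IsCompl
      (LinearMap.ker (Matrix.mulVecLin
        ((tb : ℂ) • (1 : Matrix (Fin N) (Fin N) ℂ)
          + ((∑ j, (hb j : ℂ) • A j) + (xb : ℂ) • Ad))))
      (LinearMap.range (Matrix.mulVecLin
        ((tb : ℂ) • (1 : Matrix (Fin N) (Fin N) ℂ)
          + ((∑ j, (hb j : ℂ) • A j) + (xb : ℂ) • Ad)))))
    (hdim : Module.finrank ℂ
      (LinearMap.ker (Matrix.mulVecLin
        ((tb : ℂ) • (1 : Matrix (Fin N) (Fin N) ℂ)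
          + ((∑ j, (hb j : ℂ) • A j) + (xb : ℂ) • Ad)))) = m)
    (hng : MvPolynomial.eval
        ((Fin.cons (0 : ℂ) (Fin.snoc (fun _ => (0 : ℂ)) (1 : ℂ))) : Fin (d + 2) → ℂ)
        (taylorTermBdry A Ad tb hb xb m) ≠ 0) :
    IsCompl
      (LinearMap.ker (Matrix.mulVecLin
        ((xb : ℂ) • (1 : Matrix (Fin N) (Fin N) ℂ)
          + Ad⁻¹ * ((tb : ℂ) • (1 : Matrix (Fin N) (Fin N) ℂ) + ∑ j, (hb j : ℂ) • A j))))
      (LinearMap.range (Matrix.mulVecLin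
        ((xb : ℂ) • (1 : Matrix (Fin N) (Fin N) ℂ)
          + Ad⁻¹ * ((tb : ℂ) • (1 : Matrix (Fin N) (Fin N) ℂ) + ∑ j, (hb j : ℂ) • A j)))) ∧
    Module.finrank ℂ
      (LinearMap.ker (Matrix.mulVecLin
        ((xb : ℂ) • (1 : Matrix (Fin N) (Fin N) ℂ)
          + Ad⁻¹ * ((tb : ℂ) • (1 : Matrix (Fin N) (Fin N) ℂ) + ∑ j, (hb j : ℂ) • A j)))) = m := by
  have hAd' : IsUnit Ad := (Matrix.isUnit_iff_isUnit_det _).2 hAd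
  set M : Matrix (Fin N) (Fin N) ℂ := (xb : ℂ) • (1 : Matrix (Fin N) (Fin N) ℂ)
    + Ad⁻¹ * ((tb : ℂ) • (1 : Matrix (Fin N) (Fin N) ℂ) + ∑ j, (hb j : ℂ) • A j) with hMdef
  have hAM : (tb : ℂ) • (1 : Matrix (Fin N) (Fin N) ℂ)
      + ((∑ j, (hb j : ℂ) • A j) + (xb : ℂ) • Ad) = Ad * M := by
    rw [hMdef, mul_add, Matrix.mul_nonsing_inv_cancel_left _ _ hAd, mul_smul_comm, mul_one]
    abel
  have hker : LinearMap.ker (Ad * M).mulVecLin = LinearMap.ker M.mulVecLin := by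
    rw [Matrix.mulVecLin_mul]
    exact LinearMap.ker_comp_of_ker_eq_bot _
      (LinearMap.ker_eq_bot.2 (Matrix.mulVec_injective_of_isUnit hAd'))
  rw [hAM, hker] at hdim
  rw [taylorTermBdry, eval_homogeneousComponent_eq_coeff,
    aeval_bind₁_charMvPolyBdry A Ad hAd, ← hMdef, Polynomial.coeff_C_mul] at hng
  have hneg : (-M).mulVecLin = -M.mulVecLin := by
    ext; simp
  refine ⟨?_, hdim⟩
  have h := LinearMap.isCompl_ker_range_of_coeff_charpoly_ne_zero (-M).mulVecLin (by
    rw [hneg, LinearMap.ker_neg, hdim, ← hneg, ← Matrix.toLin'_apply', Matrix.charpoly_toLin']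
    exact right_ne_zero_of_mul hng)
  rwa [hneg, LinearMap.ker_neg, LinearMap.range_neg] at h
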